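/- Let S be a commutative *-semigroup with a neutral element 0 and let u ∈ S satisfy σ(u+u) = 1 and σ(u) = σ(u*) for every character σ on S. Then the function s ↦ φ(s+u) has a finite number of negative squares for every positive definite φ : S → ℂ if and only if the function c ↦ ψ(c + [u]) has a finite number of negative squares for every positive definite ψ : S/∼ → ℂ. -/

import Mathlib

open scoped ComplexOrder

/-- `σ : S → ℂ` is a character on the commutative `*`-semigroup `(S, add, st)`:
it is not identically zero, multiplicative and `*`-preserving. -/
def IsChar {S : Type*} (add : S → S → S) (st : S → S) (σ : S → ℂ) : Prop :=
  (∃ s, σ s ≠ 0) ∧ (∀ a b, σ (add a b) = σ a * σ b) ∧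
    (∀ a, σ (st a) = starRingEnd ℂ (σ a))

/-- `φ : S → ℂ` is positive definite on the commutative `*`-semigroup `(S, add, st)`. -/
def IsPosDefFn {S : Type*} (add : S → S → S) (st : S → S) (φ : S → ℂ) : Prop :=
  ∀ (n : ℕ) (s : Fin n → S) (ξ : Fin n → ℂ),
    0 ≤ ∑ i, ∑ j, ξ i * starRingEnd ℂ (ξ j) * φ (add (st (s j)) (s i))

/-- number of negative eigenvalues (with multiplicities) of a Hermitian matrix. -/
noncomputable def negEigCount {n : ℕ} {A : Matrix (Fin n) (Fin n) ℂ}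
    (hA : A.IsHermitian) : ℕ :=
  (Finset.univ.filter fun i => hA.eigenvalues i < 0).card

/-- The number of negative squares of `ψ` is at most `k`: every Hermitian matrix
`(ψ (sᵢ + sⱼ*))ᵢⱼ` has at most `k` negative eigenvalues, counted with multiplicities. -/
def NegSquaresLE {S : Type*} (add : S → S → S) (st : S → S) (ψ : S → ℂ) (k : ℕ) : Prop :=
  ∀ (n : ℕ) (s : Fin n → S)
    (h : (Matrix.of fun i j : Fin n => ψ (add (s i) (st (s j)))).IsHermitian),
    negEigCount h ≤ k

/-- `ψ` has a finite number of negative squares. -/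
def HasFinNegSquares {S : Type*} (add : S → S → S) (st : S → S) (ψ : S → ℂ) : Prop :=
  ∃ k, NegSquaresLE add st ψ k

/-- The relation `s ∼ t` iff `σ s = σ t` for all characters `σ`. -/
def charEquiv {S : Type*} (add : S → S → S) (st : S → S) : Setoid S where
  r a b := ∀ σ : S → ℂ, IsChar add st σ → σ a = σ b
  iseqv := ⟨fun _ _ _ => rfl, fun h σ hσ => (h σ hσ).symm,
    fun h1 h2 σ hσ => (h1 σ hσ).trans (h2 σ hσ)⟩

/-- Addition on the greatest `*`-separative `*`-homomorphic image `S/∼`. -/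
def qAdd {S : Type*} (add : S → S → S) (st : S → S) :
    Quotient (charEquiv add st) → Quotient (charEquiv add st) → Quotient (charEquiv add st) :=
  Quotient.map₂ add (by
    intro a b hab c d hcd σ hσ
    rw [hσ.2.1, hσ.2.1, hab σ hσ, hcd σ hσ])

/-- Involution on `S/∼`. -/
def qStar {S : Type*} (add : S → S → S) (st : S → S) :
    Quotient (charEquiv add st) → Quotient (charEquiv add st) :=
  Quotient.map st (by
    intro a b hab σ hσ
    rw [hσ.2.2, hσ.2.2, hab σ hσ])

section PositiveInvolution

variable {A : Type*} [CommRing A]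

theorem mul_eq_zero_of_dvd_pow [IsReduced A] {x a w : A} {k : ℕ} (hx : x ∣ a ^ k)
    (h : x * w = 0) : a * w = 0 := by
  obtain ⟨y, hy⟩ := hx
  refine eq_zero_of_pow_eq_zero (n := k + 1) ?_
  calc (a * w) ^ (k + 1) = a ^ k * (a * w ^ (k + 1)) := by ring
    _ = x * w * (y * a * w ^ k) := by rw [hy]; ring
    _ = 0 := by rw [h, zero_mul]

variable {τ : A →+* A}

theorem isReduced_of_involution_mul_self_eq_zero
    (hpos : ∀ x : A, τ x * x = 0 → x = 0) (hτ : ∀ x, τ (τ x) = x) : IsReduced A := by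
  refine isReduced_iff_pow_one_lt 2 one_lt_two |>.2 fun x hx => hpos x (hpos _ ?_)
  rw [map_mul, hτ, show x * τ x * (τ x * x) = τ x ^ 2 * x ^ 2 by ring, hx, mul_zero]

/-- In a commutative ring with a positive involution, `s = t` as soon as `s` and `t` have the same
face, differ by a quotient of two hermitian squares, and `s⋆s`, `t⋆t` differ by torsion. -/
theorem eq_of_positive_involution (hτ : ∀ x, τ (τ x) = x)
    (hpos : ∀ (n : ℕ) (f : ℕ → A), ∑ i ∈ Finset.range n, τ (f i) * f i = 0 →
      ∀ i < n, f i = 0)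
    {s t p q c d : A} {n : ℕ} (hn : n ≠ 0)
    (hp : ∃ k, p ∣ (τ s * s) ^ k) (hq : ∃ k, q ∣ (τ s * s) ^ k)
    (hc : ∃ k, c ∣ (τ s * s) ^ k) (hd : ∃ k, d ∣ (τ s * s) ^ k)
    (hst : ∃ k, τ s * s ∣ (τ t * t) ^ k)
    (h₁ : c * (s * (τ q * q)) = c * (t * (τ p * p)))
    (h₂ : d * (τ s * s) ^ n = d * (τ t * t) ^ n) : s = t := by
  have hpos₁ : ∀ x : A, τ x * x = 0 → x = 0 := fun x hx =>
    hpos 1 (fun _ => x) (by simpa using hx) 0 one_pos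
  have : IsReduced A := isReduced_of_involution_mul_self_eq_zero hpos₁ hτ
  obtain ⟨kp, hp⟩ := hp
  obtain ⟨kq, hq⟩ := hq
  obtain ⟨kc, hc⟩ := hc
  obtain ⟨kd, hd⟩ := hd
  obtain ⟨ks, hst⟩ := hst
  set a := τ s * s with ha
  set b := τ t * t with hb
  set P := τ p * p with hP
  set Q := τ q * q with hQ
  have hτa : τ a = a := by rw [ha, map_mul, hτ, mul_comm]
  have hτP : τ P = P := by rw [hP, map_mul, hτ, mul_comm]
  have hτQ : τ Q = Q := by rw [hQ, map_mul, hτ, mul_comm]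
  have hQa : Q ∣ a ^ (kq + kq) := by
    rw [pow_add]
    refine mul_dvd_mul ?_ hq
    have := map_dvd τ hq
    rwa [map_pow, hτa] at this
  have e₁ : a * (s * Q) = a * (t * P) := by
    have := mul_eq_zero_of_dvd_pow hc (w := s * Q - t * P) (by rw [mul_sub, h₁, sub_self])
    rwa [mul_sub, sub_eq_zero] at this
  have e₂ : a * a ^ n = a * b ^ n := by
    have := mul_eq_zero_of_dvd_pow hd (w := a ^ n - b ^ n) (by rw [mul_sub, h₂, sub_self])
    rwa [mul_sub, sub_eq_zero] at this
  have e₃ : a * (τ s * Q) = a * (τ t * P) := by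
    have := congrArg τ e₁
    simpa only [map_mul, hτa, hτP, hτQ] using this
  have e₄ : a ^ 2 * (a * Q ^ 2) = a ^ 2 * (b * P ^ 2) := by
    calc a ^ 2 * (a * Q ^ 2) = (a * (s * Q)) * (a * (τ s * Q)) := by rw [ha]; ring
      _ = (a * (t * P)) * (a * (τ t * P)) := by rw [e₁, e₃]
      _ = a ^ 2 * (b * P ^ 2) := by rw [hb]; ring
  have e₅ : a * (Q ^ (2 * n) - P ^ (2 * n)) = 0 := by
    refine mul_eq_zero_of_dvd_pow (x := a ^ (3 * n + 1)) dvd_rfl ?_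
    rw [mul_sub, sub_eq_zero]
    calc a ^ (3 * n + 1) * Q ^ (2 * n) = (a ^ 2 * (a * Q ^ 2)) ^ n * a := by ring
      _ = (a * b ^ n) * (a ^ (2 * n) * P ^ (2 * n)) := by rw [e₄]; ring
      _ = a ^ (3 * n + 1) * P ^ (2 * n) := by rw [← e₂]; ring
  have e₆ : a * (Q - P) = 0 := by
    set v := a * (Q - P) with hv
    have hsum := hpos (2 * n) (fun i => q ^ i * p ^ (2 * n - 1 - i) * v) (by
      have hterm : ∀ i, τ (q ^ i * p ^ (2 * n - 1 - i) * v) * (q ^ i * p ^ (2 * n - 1 - i) * v) =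
          (Q ^ i * P ^ (2 * n - 1 - i)) * (τ v * v) := fun i => by
        simp only [map_mul, map_pow, hP, hQ, mul_pow]; ring
      simp only [hterm]
      rw [← Finset.sum_mul, hv, mul_left_comm, ← mul_assoc (∑ i ∈ _, _), mul_comm (∑ i ∈ _, _) a,
        mul_assoc a, (Commute.all Q P).geom_sum₂_mul, e₅, mul_zero]) 0 (by omega)
    simp only [pow_zero, one_mul, Nat.sub_zero] at hsum
    have : a * v = 0 := by
      refine mul_eq_zero_of_dvd_pow (k := kp * (2 * n - 1)) ?_ hsum
      rw [pow_mul]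
      exact pow_dvd_pow_of_dvd hp _
    refine mul_eq_zero_of_dvd_pow (x := a ^ 2) (k := 2) dvd_rfl ?_
    rw [pow_two, mul_assoc, ← hv, this]
  have e₇ : a * (s - t) = 0 := by
    have h : a * (a * (s - t)) = 0 := by
      refine mul_eq_zero_of_dvd_pow hQa ?_
      calc Q * (a * (s - t)) = a * (s * Q) - t * (a * Q) := by ring
        _ = -t * (a * (Q - P)) := by rw [e₁]; ring
        _ = 0 := by rw [e₆, mul_zero]
    refine mul_eq_zero_of_dvd_pow (x := a ^ 2) (k := 2) dvd_rfl ?_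
    rw [pow_two, mul_assoc, h]
  have e₈ : b * (s - t) = 0 := mul_eq_zero_of_dvd_pow hst e₇
  have e₉ : τ s * (s - t) = 0 := hpos₁ _ <| by
    rw [map_mul, hτ, show s * τ (s - t) * (τ s * (s - t)) = τ (s - t) * (a * (s - t)) by
      rw [ha]; ring, e₇, mul_zero]
  have e₁₀ : τ t * (s - t) = 0 := hpos₁ _ <| by
    rw [map_mul, hτ, show t * τ (s - t) * (τ t * (s - t)) = τ (s - t) * (b * (s - t)) by
      rw [hb]; ring, e₈, mul_zero]
  refine sub_eq_zero.1 (hpos₁ _ ?_)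
  rw [map_sub, sub_mul, e₉, e₁₀, sub_zero]

end PositiveInvolution

section Separation

variable {G : Type*} [CommGroup G]

theorem exists_hom_real_ne_one {g : G} (hg : ¬ IsOfFinOrder g) :
    ∃ ρ : G →* Multiplicative ℝ, ρ g ≠ 1 := by
  obtain ⟨h, hh⟩ := (Module.Baer.of_divisible ℝ).extension_property_addMonoidHom
    (zmultiplesHom (Additive G) (Additive.ofMul g))
    (fun m n hmn => injective_zpow_iff_not_isOfFinOrder.2 hg hmn) (Int.castAddHom ℝ)
  refine ⟨AddMonoidHom.toMultiplicativeRight h, fun h1 => ?_⟩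
  have h2 : h (Additive.ofMul g) = 1 := by simpa using DFunLike.congr_fun hh 1
  have h3 : h (Additive.ofMul g) = 0 := h1
  exact one_ne_zero (h2.symm.trans h3)

theorem exists_hom_circle_ne_one {g : G} (hg : g ≠ 1) : ∃ χ : G →* Circle, χ g ≠ 1 := by
  obtain ⟨c, hc⟩ := CharacterModule.exists_character_apply_ne_zero_of_ne_zero
    (A := Additive G) (a := Additive.ofMul g) hg
  let e : ℚ →+ Additive Circle :=
    { toFun := fun r => Additive.ofMul (Circle.exp (r * (2 * Real.pi)))
      map_zero' := by simp
      map_add' := fun x y => by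
        rw [← ofMul_mul, ← Circle.exp_add]; push_cast; ring_nf }
  have he : ∀ r : ℚ, e r = 0 ↔ r ∈ AddSubgroup.zmultiples (1 : ℚ) := fun r => by
    change Circle.exp (r * (2 * Real.pi)) = 1 ↔ _
    rw [Circle.exp_eq_one, AddSubgroup.mem_zmultiples_iff]
    refine exists_congr fun n => ?_
    rw [mul_left_inj' Real.two_pi_pos.ne', zsmul_one, eq_comm]
    exact_mod_cast Iff.rfl
  let E : AddCircle (1 : ℚ) →+ Additive Circle := QuotientAddGroup.lift _ e fun r hr => (he r).2 hr
  have hE : ∀ x, E x = 0 → x = 0 := fun x => by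
    induction x using QuotientAddGroup.induction_on with
    | H r => exact fun h => (QuotientAddGroup.eq_zero_iff r).2 ((he r).1 h)
  exact ⟨MonoidHom.toAdditive.symm (E.comp c), fun h => hc (hE _ h)⟩

end Separation

section Face

variable {M : Type*} [CommMonoid M]

/-- The face generated by `a`: the elements dividing some power of `a`. -/
def face (a : M) : Submonoid M where
  carrier := {x | ∃ k, x ∣ a ^ k}
  one_mem' := ⟨0, one_dvd _⟩
  mul_mem' := by
    rintro x y ⟨k, hk⟩ ⟨l, hl⟩
    exact ⟨k + l, pow_add a k l ▸ mul_dvd_mul hk hl⟩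

theorem self_mem_face (a : M) : a ∈ face a := ⟨1, by rw [pow_one]⟩

theorem mul_mem_face_iff {a x y : M} : x * y ∈ face a ↔ x ∈ face a ∧ y ∈ face a :=
  ⟨fun ⟨k, hk⟩ => ⟨⟨k, dvd_of_mul_right_dvd hk⟩, ⟨k, dvd_of_mul_left_dvd hk⟩⟩,
    fun h => mul_mem h.1 h.2⟩

variable {st : M →* M} {a : M}

theorem map_mem_face (ha : st a = a) {x : M} (hx : x ∈ face a) : st x ∈ face a := by
  obtain ⟨k, hk⟩ := hx
  exact ⟨k, by simpa [ha] using map_dvd st hk⟩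

theorem map_mem_face_iff (hst : ∀ x, st (st x) = x) (ha : st a = a) {x : M} :
    st x ∈ face a ↔ x ∈ face a :=
  ⟨fun h => hst x ▸ map_mem_face ha h, map_mem_face ha⟩

open scoped Classical in
/-- Extension by zero of a function on a face. -/
noncomputable def extendFace (f : face a →* ℂ) (x : M) : ℂ :=
  if h : x ∈ face a then f ⟨x, h⟩ else 0

theorem extendFace_of_mem (f : face a →* ℂ) (x : face a) : extendFace f x = f x :=
  dif_pos x.2

theorem isChar_extendFace (hst : ∀ x, st (st x) = x) (ha : st a = a) (f : face a →* ℂ)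
    (hf : ∀ x : face a, f ⟨st x, map_mem_face ha x.2⟩ = starRingEnd ℂ (f x)) :
    IsChar (fun x y : M => x * y) st (extendFace f) := by
  refine ⟨⟨1, ?_⟩, fun x y => ?_, fun x => ?_⟩
  · rw [← (face a).coe_one, extendFace_of_mem, map_one]
    exact one_ne_zero
  · by_cases hxy : x * y ∈ face a
    · obtain ⟨hx, hy⟩ := mul_mem_face_iff.1 hxy
      simp only [extendFace, hx, hy, hxy, dif_pos]
      exact map_mul f ⟨x, hx⟩ ⟨y, hy⟩
    · by_cases hx : x ∈ face a
      · have hy : y ∉ face a := fun hy => hxy (mul_mem hx hy)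
        simp [extendFace, hxy, hy]
      · simp [extendFace, hxy, hx]
  · by_cases hx : x ∈ face a
    · simpa only [extendFace, hx, map_mem_face ha hx, dif_pos] using hf ⟨x, hx⟩
    · simp [extendFace, hx, map_mem_face_iff hst ha]

theorem mem_face_of_forall_isChar_eq (hst : ∀ x, st (st x) = x) (ha : st a = a) {s t : M}
    (h : ∀ σ : M → ℂ, IsChar (fun x y : M => x * y) st σ → σ s = σ t) (hs : s ∈ face a) :
    t ∈ face a := by
  by_contra ht
  have := h _ (isChar_extendFace hst ha 1 fun x => by simp)
  simp [extendFace, hs, ht] at this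

/-- The map `x ↦ x⋆x` on a `⋆`-invariant face. -/
def faceNorm (st : M →* M) (ha : st a = a) : face a →* face a :=
  ((st.comp (face a).subtype).codRestrict (face a) fun x => map_mem_face ha x.2) * MonoidHom.id _

@[simp] theorem coe_faceNorm (ha : st a = a) (x : face a) :
    (faceNorm st ha x : M) = st x * x := rfl

theorem faceNorm_map (hst : ∀ x, st (st x) = x) (ha : st a = a) (x : face a) :
    faceNorm st ha ⟨st x, map_mem_face ha x.2⟩ = faceNorm st ha x :=
  Subtype.ext <| by simp [hst, mul_comm]

end Face

section Grothendieck

open Algebra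

variable {F : Type*} [CommMonoid F]

theorem grothendieckGroup_of_eq_of_iff {x y : F} :
    GrothendieckGroup.of x = GrothendieckGroup.of y ↔ ∃ c, c * x = c * y := by
  refine (Localization.monoidOf (⊤ : Submonoid F)).eq_iff_exists.trans ?_
  simp

theorem exists_eq_of_div_of (g : GrothendieckGroup F) :
    ∃ p q : F, g = GrothendieckGroup.of p / GrothendieckGroup.of q := by
  obtain ⟨⟨p, q⟩, h⟩ := (Localization.monoidOf (⊤ : Submonoid F)).surj g
  exact ⟨p, q, eq_div_of_mul_eq' h⟩

end Grothendieck

section CharacterSeparation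

open Algebra

variable {M : Type*} [CommMonoid M] {st : M →* M} {a : M}

/-- Hermitian squares that are not separated by positive characters differ by torsion. -/
theorem exists_mul_pow_eq_of_forall_isChar_eq (hst : ∀ x, st (st x) = x) (ha : st a = a)
    {s t : face a} (h : ∀ σ : M → ℂ, IsChar (fun x y : M => x * y) st σ → σ s = σ t) :
    ∃ n ≠ 0, ∃ d ∈ face a, d * (st s * s : M) ^ n = d * (st t * t : M) ^ n := by
  set g := GrothendieckGroup.of (faceNorm st ha s) / GrothendieckGroup.of (faceNorm st ha t)
    with hg
  have hfin : IsOfFinOrder g := by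
    by_contra hinf
    obtain ⟨ρ, hρ⟩ := exists_hom_real_ne_one hinf
    let ε : Multiplicative ℝ →* ℂ :=
      { toFun := fun r => (Real.exp r.toAdd : ℂ)
        map_one' := by simp
        map_mul' := fun x y => by simp [Complex.exp_add] }
    have hε : Function.Injective ε := fun x y hxy =>
      Multiplicative.toAdd.injective (Real.exp_injective (Complex.ofReal_injective hxy))
    have hσ := h _ (isChar_extendFace hst ha
      (ε.comp (ρ.comp (GrothendieckGroup.of.comp (faceNorm st ha)))) fun x => by
        simp only [MonoidHom.comp_apply, faceNorm_map hst ha x]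
        exact (Complex.conj_ofReal _).symm)
    simp only [extendFace_of_mem, MonoidHom.comp_apply] at hσ
    exact hρ (by rw [hg, map_div, hε hσ, div_self'])
  obtain ⟨n, hn, hgn⟩ := isOfFinOrder_iff_pow_eq_one.1 hfin
  rw [hg, div_pow, div_eq_one, ← map_pow GrothendieckGroup.of, ← map_pow GrothendieckGroup.of,
    grothendieckGroup_of_eq_of_iff] at hgn
  obtain ⟨d, hd⟩ := hgn
  exact ⟨n, hn.ne', d, d.2, by simpa using congrArg (Subtype.val) hd⟩

/-- Elements that are not separated by unimodular characters differ by a quotient of hermitian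
squares. -/
theorem exists_mul_norm_eq_of_forall_isChar_eq (hst : ∀ x, st (st x) = x) (ha : st a = a)
    {s t : face a} (h : ∀ σ : M → ℂ, IsChar (fun x y : M => x * y) st σ → σ s = σ t) :
    ∃ p ∈ face a, ∃ q ∈ face a, ∃ c ∈ face a,
      c * (s * (st q * q) : M) = c * (t * (st p * p) : M) := by
  let ν : GrothendieckGroup (face a) →* GrothendieckGroup (face a) :=
    GrothendieckGroup.lift (GrothendieckGroup.of.comp (faceNorm st ha))
  have hν : ∀ x, ν (GrothendieckGroup.of x) = GrothendieckGroup.of (faceNorm st ha x) := fun x =>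
    DFunLike.congr_fun (GrothendieckGroup.lift.symm_apply_apply
      (GrothendieckGroup.of.comp (faceNorm st ha))) x
  have hmem : GrothendieckGroup.of s / GrothendieckGroup.of t ∈ ν.range := by
    by_contra hmem
    obtain ⟨χ, hχ⟩ := exists_hom_circle_ne_one (G := GrothendieckGroup (face a) ⧸ ν.range)
      (mt (QuotientGroup.eq_one_iff _).1 hmem)
    let f : face a →* Circle := χ.comp ((QuotientGroup.mk' ν.range).comp GrothendieckGroup.of)
    have hf : ∀ x, f (faceNorm st ha x) = 1 := fun x => by
      have : (QuotientGroup.mk' ν.range) (GrothendieckGroup.of (faceNorm st ha x)) = 1 :=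
        (QuotientGroup.eq_one_iff _).2 ⟨GrothendieckGroup.of x, hν x⟩
      simp only [f, MonoidHom.comp_apply, this, map_one]
    have hσ := h _ (isChar_extendFace hst ha (Circle.coeHom.comp f) fun x => by
      have h1 : f ⟨st x, map_mem_face ha x.2⟩ * f x = 1 := by rw [← map_mul]; exact hf x
      simp only [MonoidHom.comp_apply, eq_inv_of_mul_eq_one_left h1]
      exact Circle.coe_inv_eq_conj _)
    simp only [extendFace_of_mem, MonoidHom.comp_apply] at hσ
    have hst : f s = f t := Circle.ext hσ
    refine hχ ?_
    change χ (QuotientGroup.mk' ν.range (GrothendieckGroup.of s / GrothendieckGroup.of t)) = 1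
    rw [map_div, map_div, div_eq_one]
    exact hst
  obtain ⟨g, hg⟩ := hmem
  obtain ⟨p, q, rfl⟩ := exists_eq_of_div_of g
  rw [map_div, hν, hν, eq_comm, div_eq_div_iff_mul_eq_mul, mul_comm (GrothendieckGroup.of _)
    (GrothendieckGroup.of t), ← map_mul, ← map_mul, grothendieckGroup_of_eq_of_iff] at hg
  obtain ⟨c, hc⟩ := hg
  exact ⟨p, p.2, q, q.2, c, c.2, by simpa using congrArg Subtype.val hc⟩

end CharacterSeparation

section PositiveFunctional

variable {M : Type*} [CommMonoid M]

/-- The conjugate-linear involution of `ℂ[M]` induced by an involution of `M`. -/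
noncomputable def algInvol (st : M →* M) : MonoidAlgebra ℂ M →+* MonoidAlgebra ℂ M :=
  (MonoidAlgebra.mapRingHom M (starRingEnd ℂ)).comp (MonoidAlgebra.mapDomainRingHom ℂ st)

@[simp] theorem algInvol_single (st : M →* M) (m : M) (c : ℂ) :
    algInvol st (MonoidAlgebra.single m c) = MonoidAlgebra.single (st m) (starRingEnd ℂ c) := by
  simp [algInvol]

/-- The linear functional on `ℂ[M]` extending `φ`. -/
noncomputable def algFunctional {M : Type*} (φ : M → ℂ) : MonoidAlgebra ℂ M →ₗ[ℂ] ℂ :=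
  Finsupp.linearCombination ℂ φ ∘ₗ (MonoidAlgebra.coeffLinearEquiv ℂ).toLinearMap

@[simp] theorem algFunctional_single {M : Type*} (φ : M → ℂ) (m : M) (c : ℂ) :
    algFunctional φ (MonoidAlgebra.single m c) = c * φ m := by
  simp [algFunctional]

variable {st : M →* M} {φ : M → ℂ}

theorem algInvol_algInvol (hst : ∀ x, st (st x) = x) (x : MonoidAlgebra ℂ M) :
    algInvol st (algInvol st x) = x := by
  induction x using MonoidAlgebra.induction_linear with
  | zero => simp
  | add x y hx hy => rw [map_add, map_add, hx, hy]
  | single m r => simp [hst]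

theorem exists_eq_sum_single {M : Type*} (x : MonoidAlgebra ℂ M) :
    ∃ (n : ℕ) (s : Fin n → M) (ξ : Fin n → ℂ), x = ∑ i, MonoidAlgebra.single (s i) (ξ i) := by
  refine ⟨x.coeff.support.card, fun i => (x.coeff.support.equivFin.symm i : M),
    fun i => x.coeff (x.coeff.support.equivFin.symm i), ?_⟩
  rw [Equiv.sum_comp x.coeff.support.equivFin.symm
    (fun m => MonoidAlgebra.single (m : M) (x.coeff m)),
    Finset.sum_coe_sort x.coeff.support (fun m => MonoidAlgebra.single m (x.coeff m))]
  exact (MonoidAlgebra.sum_coeff_single x).symm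

theorem algFunctional_nonneg (hφ : IsPosDefFn (fun x y : M => x * y) st φ)
    (x : MonoidAlgebra ℂ M) : 0 ≤ algFunctional φ (algInvol st x * x) := by
  obtain ⟨n, s, ξ, rfl⟩ := exists_eq_sum_single x
  refine (hφ n s ξ).trans_eq ?_
  rw [map_sum, Finset.sum_mul_sum, Finset.sum_comm, map_sum]
  refine Finset.sum_congr rfl fun j _ => ?_
  rw [map_sum]
  refine Finset.sum_congr rfl fun i _ => ?_
  simp [MonoidAlgebra.single_mul_single, mul_comm]

theorem posDef_map_eq_conj (hφ : IsPosDefFn (fun x y : M => x * y) st φ) (m : M) :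
    φ (st m) = starRingEnd ℂ (φ m) := by
  have key : ∀ c : ℂ, (c * φ m + starRingEnd ℂ c * φ (st m)).im = 0 := fun c => by
    have h := (Complex.nonneg_iff.1 (algFunctional_nonneg hφ
      (1 + MonoidAlgebra.single m c))).2
    have h0 := (Complex.nonneg_iff.1 (algFunctional_nonneg hφ 1)).2
    have h1 := (Complex.nonneg_iff.1 (algFunctional_nonneg hφ (MonoidAlgebra.single m c))).2
    rw [map_add, map_one, add_mul, one_mul, mul_add, mul_one, map_add, map_add, map_add,
      Complex.add_im, Complex.add_im, Complex.add_im, ← h1] at h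
    rw [map_one, mul_one] at h0
    rw [← h0, algInvol_single, algFunctional_single, algFunctional_single] at h
    rw [Complex.add_im]
    linarith
  have h1 := key 1
  have h2 := key Complex.I
  simp at h1 h2
  apply Complex.ext <;> simp <;> linarith

theorem algFunctional_algInvol (hφ : IsPosDefFn (fun x y : M => x * y) st φ)
    (x : MonoidAlgebra ℂ M) :
    algFunctional φ (algInvol st x) = starRingEnd ℂ (algFunctional φ x) := by
  induction x using MonoidAlgebra.induction_linear with
  | zero => simp
  | add x y hx hy => rw [map_add, map_add, hx, hy, map_add, map_add]
  | single m r => simp [posDef_map_eq_conj hφ]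

/-- The semi-inner product on `ℂ[M]` induced by a positive definite function. -/
@[reducible] noncomputable def algPreInner (hst : ∀ x, st (st x) = x)
    (hφ : IsPosDefFn (fun x y : M => x * y) st φ) :
    PreInnerProductSpace.Core ℂ (MonoidAlgebra ℂ M) where
  inner x y := algFunctional φ (algInvol st x * y)
  conj_inner_symm x y := by
    rw [← algFunctional_algInvol hφ, map_mul, algInvol_algInvol hst, mul_comm]
  re_inner_nonneg x := (Complex.nonneg_iff.1 (algFunctional_nonneg hφ x)).1
  add_left x y z := by rw [map_add, add_mul, map_add]
  smul_left x y r := by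
    have : algInvol st (r • x) = starRingEnd ℂ r • algInvol st x := by
      induction x using MonoidAlgebra.induction_linear with
      | zero => simp
      | add x y hx hy => rw [smul_add, map_add, map_add, hx, hy, smul_add]
      | single m c => simp
    rw [this, smul_mul_assoc, map_smul, smul_eq_mul]

/-- The null ideal of the functional induced by `φ`. -/
noncomputable def nullIdeal (φ : M → ℂ) : Ideal (MonoidAlgebra ℂ M) where
  carrier := {x | ∀ y, algFunctional φ (y * x) = 0}
  zero_mem' y := by simp
  add_mem' hx hy w := by rw [mul_add, map_add, hx w, hy w, add_zero]
  smul_mem' c x hx y := by rw [smul_eq_mul, ← mul_assoc]; exact hx _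

theorem mem_nullIdeal_of_algFunctional_eq_zero (hst : ∀ x, st (st x) = x)
    (hφ : IsPosDefFn (fun x y : M => x * y) st φ) {x : MonoidAlgebra ℂ M}
    (hx : algFunctional φ (algInvol st x * x) = 0) : x ∈ nullIdeal φ := by
  intro y
  let := algPreInner hst hφ
  have h : ‖algFunctional φ (algInvol st x * algInvol st y)‖ *
      ‖algFunctional φ (algInvol st (algInvol st y) * x)‖ ≤
      (algFunctional φ (algInvol st x * x)).re *
        (algFunctional φ (algInvol st (algInvol st y) * algInvol st y)).re :=
    InnerProductSpace.Core.inner_mul_inner_self_le (𝕜 := ℂ) x (algInvol st y)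
  rw [hx, Complex.zero_re, zero_mul, ← map_mul, algFunctional_algInvol hφ, RCLike.norm_conj,
    algInvol_algInvol hst, mul_comm x y] at h
  exact norm_eq_zero.1 (mul_self_eq_zero.1 (le_antisymm h (mul_self_nonneg _)))

theorem nullIdeal_le_comap (hst : ∀ x, st (st x) = x)
    (hφ : IsPosDefFn (fun x y : M => x * y) st φ) :
    nullIdeal φ ≤ (nullIdeal φ).comap (algInvol st) := fun x hx y => by
  have := congrArg (starRingEnd ℂ) (hx (algInvol st y))
  rwa [← algFunctional_algInvol hφ, map_mul, algInvol_algInvol hst, map_zero] at this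

theorem mem_nullIdeal_of_sum_mem (hst : ∀ x, st (st x) = x)
    (hφ : IsPosDefFn (fun x y : M => x * y) st φ) {n : ℕ} {f : ℕ → MonoidAlgebra ℂ M}
    (h : ∑ i ∈ Finset.range n, algInvol st (f i) * f i ∈ nullIdeal φ) {i : ℕ} (hi : i < n) :
    f i ∈ nullIdeal φ := by
  refine mem_nullIdeal_of_algFunctional_eq_zero hst hφ ?_
  have := h 1
  rw [one_mul, map_sum, Finset.sum_eq_zero_iff_of_nonneg fun i _ => algFunctional_nonneg hφ _]
    at this
  exact this i (Finset.mem_range.2 hi)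

/-- Positive definite functions do not separate more points than characters do. -/
theorem IsPosDefFn.eq_of_forall_isChar_eq (hst : ∀ x, st (st x) = x)
    (hφ : IsPosDefFn (fun x y : M => x * y) st φ) {s t : M}
    (h : ∀ σ : M → ℂ, IsChar (fun x y : M => x * y) st σ → σ s = σ t) : φ s = φ t := by
  have hsq : ∀ x : M, st (st x * x) = st x * x := fun x => by rw [map_mul, hst, mul_comm]
  have hs : s ∈ face (st s * s) := (mul_mem_face_iff.1 (self_mem_face _)).2
  have ht : t ∈ face (st s * s) := mem_face_of_forall_isChar_eq hst (hsq s) h hs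
  have hs' : s ∈ face (st t * t) := mem_face_of_forall_isChar_eq hst (hsq t)
    (fun σ hσ => (h σ hσ).symm) (mul_mem_face_iff.1 (self_mem_face _)).2
  obtain ⟨n, hn, d, hd, h₂⟩ :=
    exists_mul_pow_eq_of_forall_isChar_eq hst (hsq s) (s := ⟨s, hs⟩) (t := ⟨t, ht⟩) h
  obtain ⟨p, hp, q, hq, c, hc, h₁⟩ :=
    exists_mul_norm_eq_of_forall_isChar_eq hst (hsq s) (s := ⟨s, hs⟩) (t := ⟨t, ht⟩) h
  let J := nullIdeal φ
  let τ : MonoidAlgebra ℂ M ⧸ J →+* MonoidAlgebra ℂ M ⧸ J :=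
    Ideal.quotientMap J (algInvol st) (nullIdeal_le_comap hst hφ)
  let π : M →* MonoidAlgebra ℂ M ⧸ J := (Ideal.Quotient.mk J : _ →* _).comp (MonoidAlgebra.of ℂ M)
  have hπ : ∀ x, τ (π x) = π (st x) := fun x => by
    simp [τ, π]
  have hface : ∀ {x y : M}, x ∈ face (st y * y) → ∃ k, π x ∣ (τ (π y) * π y) ^ k := by
    rintro x y ⟨k, hk⟩
    exact ⟨k, by rw [hπ, ← map_mul, ← map_pow]; exact map_dvd π hk⟩
  have hπst : π s = π t := by
    refine eq_of_positive_involution (τ := τ) ?_ ?_ hn (hface hp) (hface hq) (hface hc) (hface hd)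
      ?_ ?_ ?_
    · intro x
      obtain ⟨x, rfl⟩ := Ideal.Quotient.mk_surjective x
      simp only [τ, Ideal.quotientMap_mk, algInvol_algInvol hst]
    · intro n f hf i hi
      choose g hg using fun i => Ideal.Quotient.mk_surjective (I := J) (f i)
      rw [← hg i, Ideal.Quotient.eq_zero_iff_mem]
      refine mem_nullIdeal_of_sum_mem hst hφ (n := n) ?_ hi
      refine Ideal.Quotient.eq_zero_iff_mem.1 (Eq.trans ?_ hf)
      simp only [map_sum, map_mul, ← hg, τ, Ideal.quotientMap_mk]
      rfl
    · rw [hπ, ← map_mul]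
      exact hface (mul_mem (map_mem_face (hsq t) hs') hs')
    · simpa only [hπ, map_mul] using congrArg π h₁
    · simpa only [hπ, map_mul, map_pow] using congrArg π h₂
  have hJ : MonoidAlgebra.of ℂ M s - MonoidAlgebra.of ℂ M t ∈ nullIdeal φ :=
    Ideal.Quotient.eq.1 hπst
  have := hJ 1
  simpa [sub_eq_zero] using this

end PositiveFunctional

/-- Let `S` be a commutative `*`-semigroup with a neutral element `0` and let `u ∈ S`
satisfy `σ(u+u) = 1` and `σ(u) = σ(u*)` for every character `σ` on `S`.  Then
`s ↦ φ(s+u)` has a finite number of negative squares for every positive definite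
`φ : S → ℂ` iff `c ↦ ψ(c + [u])` has a finite number of negative squares for every
positive definite `ψ : S/∼ → ℂ`. -/
theorem stmt15 {S : Type*} (add : S → S → S) (st : S → S)
    (hcomm : ∀ a b, add a b = add b a)
    (hassoc : ∀ a b c, add (add a b) c = add a (add b c))
    (hstadd : ∀ a b, st (add a b) = add (st a) (st b))
    (hstinv : ∀ a, st (st a) = a)
    (z : S) (hz : ∀ s, add z s = s)
    (u : S)
    (hu : ∀ σ : S → ℂ, IsChar add st σ → σ (add u u) = 1 ∧ σ u = σ (st u)) :
    (∀ φ : S → ℂ, IsPosDefFn add st φ →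
        HasFinNegSquares add st (fun s => φ (add s u))) ↔
      (∀ ψ : Quotient (charEquiv add st) → ℂ,
        IsPosDefFn (qAdd add st) (qStar add st) ψ →
        HasFinNegSquares (qAdd add st) (qStar add st)
          (fun c => ψ (qAdd add st c (Quotient.mk (charEquiv add st) u)))) := by
  let _ : CommMonoid S :=
    { mul := add, mul_assoc := hassoc, one := z, one_mul := hz
      mul_one := fun s => (hcomm s z).trans (hz s), mul_comm := hcomm }
  have hstz : st z = z := by
    have h := congrArg st (hz (st z))
    rwa [hstadd, hstinv, hcomm, hz] at h
  let τ : S →* S := { toFun := st, map_one' := hstz, map_mul' := hstadd }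
  constructor
  · intro h ψ hψ
    obtain ⟨k, hk⟩ := h (fun s => ψ (Quotient.mk _ s)) fun n s ξ =>
      hψ n (fun i => Quotient.mk _ (s i)) ξ
    refine ⟨k, fun n c hc => ?_⟩
    obtain ⟨s, rfl⟩ : ∃ s : Fin n → S, (fun i => Quotient.mk (charEquiv add st) (s i)) = c :=
      ⟨fun i => (c i).out, funext fun i => (c i).out_eq⟩
    exact hk n s hc
  · intro h φ hφ
    have hsep : ∀ a b, (charEquiv add st).r a b → φ a = φ b := fun a b hab =>
      IsPosDefFn.eq_of_forall_isChar_eq (st := τ) hstinv hφ hab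
    obtain ⟨k, hk⟩ := h (Quotient.lift φ hsep) fun n c ξ => by
      obtain ⟨s, rfl⟩ : ∃ s : Fin n → S, (fun i => Quotient.mk (charEquiv add st) (s i)) = c :=
        ⟨fun i => (c i).out, funext fun i => (c i).out_eq⟩
      exact hφ n s ξ
    exact ⟨k, fun n s hs => hk n (fun i => Quotient.mk _ (s i)) hs⟩
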